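/- arXiv:1706.04950 — 2 statements merged into one kernel-verified Lean document; each statement's English description precedes it below -/
import Mathlib

section
/- There exists a constant C such that for all sufficiently large n the following holds. Let G_1 be a properly edge-colored complete graph on n vertices, and set p = C (log n)/√n, a = √n, b = n/4, and δ = 4p. Then there exist edge-disjoint spanning subgraphs G, H_1, H_2, H_3 of G_1, edge-colored (by restriction of the coloring of G_1) with pairwise disjoint sets of colors, such that: (a) the minimum degree of G is at least (1 - δ)n; and (b) for every m ≤ √n and every i ∈ {1,2,3}, removing any m color classes from H_i yields an (a,b)-expander. -/
open scoped Classical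

/-- An edge-coloring of a graph is a *proper edge-coloring* if the edges incident to any
single vertex receive pairwise distinct colors. -/
def IsProperEdgeColoring {V : Type*} (G : SimpleGraph V) (c : Sym2 V → ℕ) : Prop :=
  ∀ ⦃e₁ e₂ : Sym2 V⦄, e₁ ∈ G.edgeSet → e₂ ∈ G.edgeSet → e₁ ≠ e₂ →
    (∃ v, v ∈ e₁ ∧ v ∈ e₂) → c e₁ ≠ c e₂

/-- The graph obtained from `H` by removing the color classes (w.r.t. `c`) of the colors
in `S`. -/
noncomputable def removeColors {V : Type*} (H : SimpleGraph V) (c : Sym2 V → ℕ)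
    (S : Finset ℕ) : SimpleGraph V :=
  SimpleGraph.fromEdgeSet {e | e ∈ H.edgeSet ∧ c e ∉ S}

/-- `H` is an `(a,b)`-expander (with real parameters `0 < a ≤ b`): (E1) minimum degree at
least `a`; (E2) every vertex set of size at least `a` has neighborhood of size at least
`n - a - b`; (E3) between any two disjoint vertex sets of sizes (at least) `a` and `b`
there is an edge of `H`. -/
def IsExpander {V : Type*} [Fintype V] (H : SimpleGraph V) (a b : ℝ) : Prop :=
  (∀ v, a ≤ ((H.neighborSet v).ncard : ℝ)) ∧
  (∀ A : Finset V, a ≤ (A.card : ℝ) →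
    (Fintype.card V : ℝ) - a - b ≤ ((⋃ u ∈ (A : Set V), H.neighborSet u).ncard : ℝ)) ∧
  (∀ A B : Finset V, Disjoint A B → a ≤ (A.card : ℝ) → b ≤ (B.card : ℝ) →
    ∃ u ∈ A, ∃ v ∈ B, H.Adj u v)


lemma sum_weight {κ : Type*} [Fintype κ] {M : ℕ} (K : Finset κ) (w : Fin M → ℝ) (hM : 0 < M) :
    ∑ f : κ → Fin M, ∏ k ∈ K, w (f k)
      = ((∑ x, w x) / M) ^ K.card * (M : ℝ) ^ Fintype.card κ := by
  have hM' : (M : ℝ) ≠ 0 := by positivity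
  have h1 : ∀ f : κ → Fin M, ∏ k ∈ K, w (f k) = ∏ k, (if k ∈ K then w (f k) else 1) := by
    intro f
    rw [Finset.prod_ite_mem, Finset.univ_inter]
  simp_rw [h1]
  have h2 := Finset.prod_univ_sum (fun _ : κ => (Finset.univ : Finset (Fin M)))
    (fun k x => if k ∈ K then w x else (1 : ℝ))
  rw [Fintype.piFinset_univ] at h2
  rw [← h2]
  have h3 : ∀ k : κ, ∑ x : Fin M, (if k ∈ K then w x else (1 : ℝ))
      = (if k ∈ K then (∑ x, w x) / M else 1) * M := by
    intro k
    by_cases hk : k ∈ K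
    · simp [hk]; field_simp
    · simp [hk]
  simp_rw [h3]
  rw [Finset.prod_mul_distrib, Finset.prod_ite_mem, Finset.univ_inter, Finset.prod_const,
    Finset.prod_const, Finset.card_univ]

lemma exists_good {κ : Type*} [Fintype κ] {M : ℕ} (hM : 3 ≤ M)
    (FF GG : Finset (Finset κ)) (r t a g : ℕ)
    (hF : ∀ K ∈ FF, a ≤ K.card) (hG : ∀ K ∈ GG, K.card ≤ g)
    (hsum : (3 * FF.card : ℝ) * (2 ^ r * (1 - 1 / (2 * M)) ^ a)
      + GG.card * ((1 + 3 / M) ^ g / 2 ^ t) < 1) :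
    ∃ f : κ → Fin M, (∀ K ∈ FF, ∀ i < 3, r < (K.filter (fun k => (f k).val = i)).card) ∧
      ∀ K ∈ GG, (K.filter (fun k => (f k).val < 3)).card < t := by
  have hM0 : (0 : ℝ) < M := by positivity
  have hM3 : (3 : ℝ) ≤ M := by exact_mod_cast hM
  let w : ℕ → Fin M → ℝ := fun i x => if x.val = i then 1/2 else 1
  let u : Fin M → ℝ := fun x => if x.val < 3 then 2 else 1
  have hw : ∀ i < 3, ∑ x, w i x = M - 1/2 := by
    intro i hi
    have : ∀ x : Fin M, w i x = 1 - (if x = ⟨i, by omega⟩ then 1/2 else 0) := by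
      intro x
      simp only [w, Fin.ext_iff]
      split_ifs <;> norm_num
    simp_rw [this]
    rw [Finset.sum_sub_distrib, Finset.sum_ite_eq']
    simp
  have hu : ∑ x, u x ≤ M + 3 := by
    have : ∀ x : Fin M, u x = 1 + (if x.val < 3 then 1 else 0) := by
      intro x
      simp only [u]
      split_ifs <;> norm_num
    simp_rw [this]
    rw [Finset.sum_add_distrib]
    simp only [Finset.sum_const, Finset.card_univ, Fintype.card_fin, nsmul_eq_mul, mul_one,
      Finset.sum_boole]
    have : ((Finset.univ.filter (fun x : Fin M => x.val < 3)).card) ≤ 3 := by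
      have := Finset.card_le_card_of_injOn (s := Finset.univ.filter (fun x : Fin M => x.val < 3))
        (t := Finset.range 3) (fun x => x.val) (by intro x hx; simpa using hx)
        (by intro x _ y _ h; exact Fin.ext h)
      simpa using this
    have : (((Finset.univ.filter (fun x : Fin M => x.val < 3)).card : ℕ) : ℝ) ≤ 3 := by
      exact_mod_cast this
    linarith
  have hu0 : 0 ≤ ∑ x, u x := Finset.sum_nonneg (fun x _ => by simp only [u]; split_ifs <;> norm_num)
  let Z : (κ → Fin M) → ℝ := fun f =>
    (∑ K ∈ FF, ∑ i ∈ Finset.range 3, 2 ^ r * ∏ k ∈ K, w i (f k))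
      + ∑ K ∈ GG, (1 / 2 ^ t) * ∏ k ∈ K, u (f k)
  have hpw : ∀ f : κ → Fin M, ∀ K : Finset κ, ∀ i, ∏ k ∈ K, w i (f k)
      = (1/2) ^ (K.filter (fun k => (f k).val = i)).card := by
    intro f K i
    simp only [w]
    rw [Finset.prod_ite]; simp
  have hpu : ∀ f : κ → Fin M, ∀ K : Finset κ, ∏ k ∈ K, u (f k)
      = 2 ^ (K.filter (fun k => (f k).val < 3)).card := by
    intro f K
    simp only [u]
    rw [Finset.prod_ite]; simp
  have hZ : ∑ f, Z f < ∑ f : κ → Fin M, (1 : ℝ) := by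
    have hp : (0 : ℝ) < (M : ℝ) ^ Fintype.card κ := by positivity
    have e1 : ∑ f, Z f = (∑ K ∈ FF, ∑ i ∈ Finset.range 3, 2 ^ r *
          (((∑ x, w i x) / M) ^ K.card * (M : ℝ) ^ Fintype.card κ))
        + ∑ K ∈ GG, (1 / 2 ^ t) * (((∑ x, u x) / M) ^ K.card * (M : ℝ) ^ Fintype.card κ) := by
      simp only [Z]
      rw [Finset.sum_add_distrib]
      congr 1
      · rw [Finset.sum_comm]
        refine Finset.sum_congr rfl (fun K _ => ?_)
        rw [Finset.sum_comm]
        refine Finset.sum_congr rfl (fun i _ => ?_)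
        rw [← Finset.mul_sum, sum_weight K (w i) (by omega)]
      · rw [Finset.sum_comm]
        refine Finset.sum_congr rfl (fun K _ => ?_)
        rw [← Finset.mul_sum, sum_weight K u (by omega)]
    have e2 : ∑ f : κ → Fin M, (1 : ℝ) = (M : ℝ) ^ Fintype.card κ := by simp
    have b1 : ∑ K ∈ FF, ∑ i ∈ Finset.range 3, 2 ^ r *
          (((∑ x, w i x) / M) ^ K.card * (M : ℝ) ^ Fintype.card κ)
        ≤ ∑ K ∈ FF, ∑ i ∈ Finset.range 3, 2 ^ r *
          ((1 - 1 / (2 * M)) ^ a * (M : ℝ) ^ Fintype.card κ) := by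
      refine Finset.sum_le_sum (fun K hK => Finset.sum_le_sum (fun i hi => ?_))
      rw [hw i (by simpa using hi)]
      have : ((M : ℝ) - 1/2) / M = 1 - 1 / (2 * M) := by field_simp
      rw [this]
      have h0 : (0 : ℝ) ≤ 1 - 1 / (2 * M) := by
        rw [← this]; apply div_nonneg <;> linarith
      have h1 : (1 : ℝ) - 1 / (2 * M) ≤ 1 := by
        have : (0 : ℝ) ≤ 1 / (2 * M) := by positivity
        linarith
      have := pow_le_pow_of_le_one h0 h1 (hF K hK)
      gcongr
    have b2 : ∑ K ∈ GG, (1 / 2 ^ t) * (((∑ x, u x) / M) ^ K.card * (M : ℝ) ^ Fintype.card κ)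
        ≤ ∑ K ∈ GG, (1 / 2 ^ t) * ((1 + 3 / M) ^ g * (M : ℝ) ^ Fintype.card κ) := by
      refine Finset.sum_le_sum (fun K hK => ?_)
      have h1 : (∑ x, u x) / M ≤ 1 + 3 / M := by
        have : (1 : ℝ) + 3 / M = (M + 3) / M := by field_simp
        rw [this]; gcongr
      have h2 : (1 : ℝ) ≤ 1 + 3 / M := by
        have : (0 : ℝ) ≤ 3 / M := by positivity
        linarith
      have h3 : ((∑ x, u x) / M) ^ K.card ≤ (1 + 3 / M) ^ g :=
        (pow_le_pow_left₀ (by positivity) h1 _).trans (pow_le_pow_right₀ h2 (hG K hK))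
      gcongr
    rw [e1, e2]
    refine (add_le_add b1 b2).trans_lt ?_
    simp only [Finset.sum_const, Finset.card_range, nsmul_eq_mul]
    have := mul_lt_mul_of_pos_right hsum hp
    rw [one_mul] at this
    refine lt_of_eq_of_lt ?_ this
    push_cast
    ring
  obtain ⟨f, -, hf⟩ := Finset.exists_lt_of_sum_lt hZ
  have n1 : ∀ K ∈ FF, ∀ i ∈ Finset.range 3, 0 ≤ 2 ^ r * ∏ k ∈ K, w i (f k) := by
    intro K _ i _; rw [hpw]; positivity
  have n2 : ∀ K ∈ GG, 0 ≤ (1 / 2 ^ t) * ∏ k ∈ K, u (f k) := by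
    intro K _; rw [hpu]; positivity
  have n1' : ∀ K ∈ FF, 0 ≤ ∑ i ∈ Finset.range 3, 2 ^ r * ∏ k ∈ K, w i (f k) :=
    fun K hK => Finset.sum_nonneg (n1 K hK)
  refine ⟨f, ?_, ?_⟩
  · intro K hK i hi
    have h1 := Finset.single_le_sum (n1 K hK) (Finset.mem_range.2 hi)
    have h2 := Finset.single_le_sum n1' hK
    have h3 := Finset.sum_nonneg n2
    have h4 : 2 ^ r * ∏ k ∈ K, w i (f k) < 1 := by
      simp only [Z] at hf
      linarith
    rw [hpw] at h4
    by_contra hcon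
    push Not at hcon
    have : (2 : ℝ) ^ (K.filter (fun k => (f k).val = i)).card ≤ 2 ^ r :=
      pow_le_pow_right₀ (by norm_num) hcon
    rw [one_div, inv_pow, ← div_eq_mul_inv, div_lt_one (by positivity)] at h4
    linarith
  · intro K hK
    have h1 := Finset.single_le_sum n2 hK
    have h3 := Finset.sum_nonneg n1'
    have h4 : (1 / 2 ^ t) * ∏ k ∈ K, u (f k) < 1 := by
      simp only [Z] at hf
      linarith
    rw [hpu] at h4
    by_contra hcon
    push Not at hcon
    have : (2 : ℝ) ^ t ≤ 2 ^ (K.filter (fun k => (f k).val < 3)).card :=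
      pow_le_pow_right₀ (by norm_num) hcon
    rw [one_div, mul_comm, ← div_eq_mul_inv, div_lt_one (by positivity)] at h4
    linarith

/-- version with natural number colors -/
lemma exists_good_nat {M : ℕ} (hM : 3 ≤ M)
    (FF GG : Finset (Finset ℕ)) (r t a g : ℕ)
    (hF : ∀ K ∈ FF, a ≤ K.card) (hG : ∀ K ∈ GG, K.card ≤ g)
    (hsum : (3 * FF.card : ℝ) * (2 ^ r * (1 - 1 / (2 * M)) ^ a)
      + GG.card * ((1 + 3 / M) ^ g / 2 ^ t) < 1) :
    ∃ f : ℕ → ℕ, (∀ K ∈ FF, ∀ i < 3, r < (K.filter (fun k => f k = i)).card) ∧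
      ∀ K ∈ GG, (K.filter (fun k => f k < 3)).card < t := by
  let U : Finset ℕ := (FF ∪ GG).biUnion id
  have hUsub : ∀ K ∈ FF ∪ GG, K ⊆ U := fun K hK => Finset.subset_biUnion_of_mem id hK
  let φ : Finset ℕ → Finset {x // x ∈ U} := fun K => K.subtype (fun x => x ∈ U)
  have hφ : ∀ K ∈ FF ∪ GG, (φ K).map (Function.Embedding.subtype _) = K := by
    intro K hK
    exact Finset.subtype_map_of_mem (fun x hx => hUsub K hK hx)
  have hcard : ∀ K ∈ FF ∪ GG, (φ K).card = K.card := by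
    intro K hK
    conv_rhs => rw [← hφ K hK]
    rw [Finset.card_map]
  have hM3 : (3 : ℝ) ≤ M := by exact_mod_cast hM
  have h0 : (0 : ℝ) ≤ 1 - 1 / (2 * M) := by
    have : (1 : ℝ) / (2 * M) ≤ 1 := by
      rw [div_le_one (by positivity)]; linarith
    linarith
  obtain ⟨f, hf1, hf2⟩ := exists_good (κ := {x // x ∈ U}) hM (FF.image φ) (GG.image φ) r t a g
    (by
      intro K hK
      obtain ⟨K', hK', rfl⟩ := Finset.mem_image.1 hK
      rw [hcard K' (Finset.mem_union_left _ hK')]; exact hF K' hK')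
    (by
      intro K hK
      obtain ⟨K', hK', rfl⟩ := Finset.mem_image.1 hK
      rw [hcard K' (Finset.mem_union_right _ hK')]; exact hG K' hK')
    (by
      refine lt_of_le_of_lt ?_ hsum
      have h1 : ((FF.image φ).card : ℝ) ≤ FF.card := by exact_mod_cast Finset.card_image_le
      have h2 : ((GG.image φ).card : ℝ) ≤ GG.card := by exact_mod_cast Finset.card_image_le
      gcongr)
  let F : ℕ → ℕ := fun x => if h : x ∈ U then (f ⟨x, h⟩).val else 0
  have hFf : ∀ x : {x // x ∈ U}, F x.1 = (f x).val := by
    intro x; simp [F]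
  have key : ∀ K ∈ FF ∪ GG, ∀ (P : ℕ → Prop) [DecidablePred P],
      (K.filter (fun k => P (F k))).card = ((φ K).filter (fun k => P (f k).val)).card := by
    intro K hK P _
    conv_lhs => rw [← hφ K hK]
    rw [Finset.filter_map, Finset.card_map]
    congr 1
    ext x
    simp only [Finset.mem_filter, Function.comp, Function.Embedding.subtype_apply, hFf]
  refine ⟨F, ?_, ?_⟩
  · intro K hK i hi
    rw [key K (Finset.mem_union_left _ hK) (fun y => y = i)]
    exact hf1 _ (Finset.mem_image_of_mem _ hK) i hi
  · intro K hK
    rw [key K (Finset.mem_union_right _ hK) (fun y => y < 3)]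
    exact hf2 _ (Finset.mem_image_of_mem _ hK)

/-- colors between two sets -/
noncomputable def colsBetween {n : ℕ} (c : Sym2 (Fin n) → ℕ) (A B : Finset (Fin n)) : Finset ℕ :=
  (A ×ˢ B).image (fun p => c s(p.1, p.2))

lemma greedy {n s : ℕ} (c : Sym2 (Fin n) → ℕ)
    (hc : ∀ u v w : Fin n, u ≠ v → u ≠ w → c s(u, v) = c s(u, w) → v = w)
    (A B : Finset (Fin n)) (hAB : Disjoint A B) (hA : A.card = s) (hB : n ≤ 5 * B.card) (k : ℕ) :
    ∃ B' ⊆ B, B'.card ≤ k ∧ (n ≤ 10 * (colsBetween c A B').card ∨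
      k * s ≤ 2 * (colsBetween c A B').card) := by
  induction k with
  | zero => exact ⟨∅, by simp, by simp, Or.inr (by simp)⟩
  | succ k ih =>
    obtain ⟨B', hB', hcard, h⟩ := ih
    by_cases hn : n ≤ 10 * (colsBetween c A B').card
    · exact ⟨B', hB', by omega, Or.inl hn⟩
    have h' := h.resolve_left hn
    set K := colsBetween c A B' with hK
    have hne : ∀ a ∈ A, ∀ b ∈ B, a ≠ b := fun a ha b hb hab =>
      Finset.disjoint_left.1 hAB ha (hab ▸ hb)
    -- double counting
    have hdc : ∑ b ∈ B, (A.filter (fun a => c s(a, b) ∈ K)).card ≤ s * K.card := by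
      have e : ∑ b ∈ B, (A.filter (fun a => c s(a, b) ∈ K)).card
          = ∑ a ∈ A, (B.filter (fun b => c s(a, b) ∈ K)).card := by
        simp_rw [Finset.card_filter]
        exact Finset.sum_comm
      rw [e, ← hA, ← smul_eq_mul]
      refine Finset.sum_le_card_nsmul _ _ _ (fun a ha => ?_)
      refine Finset.card_le_card_of_injOn (fun b => c s(a, b)) ?_ ?_
      · intro b hb
        exact (Finset.mem_filter.1 hb).2
      · intro b hb b2 hb2 heq
        have m1 := (Finset.mem_filter.1 hb).1
        have m2 := (Finset.mem_filter.1 hb2).1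
        exact hc a b b2 (hne a ha b m1) (hne a ha b2 m2) heq
    have hex : ∃ b ∈ B, 2 * (A.filter (fun a => c s(a, b) ∈ K)).card ≤ s := by
      by_contra hcon
      push Not at hcon
      have h1 : B.card * (s + 1) ≤ ∑ b ∈ B, 2 * (A.filter (fun a => c s(a, b) ∈ K)).card := by
        rw [← smul_eq_mul]
        exact Finset.card_nsmul_le_sum _ _ _ (fun b hb => hcon b hb)
      rw [← Finset.mul_sum] at h1
      have : 0 < B.card := by omega
      have h2 : 2 * K.card ≤ B.card := by omega
      have h3 : s * (2 * K.card) ≤ s * B.card := Nat.mul_le_mul_left _ h2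
      nlinarith
    obtain ⟨b, hb, hbs⟩ := hex
    refine ⟨insert b B', Finset.insert_subset hb hB', ?_, Or.inr ?_⟩
    · exact (Finset.card_insert_le _ _).trans (by omega)
    · have hsub : K ∪ (A.filter (fun a => c s(a, b) ∉ K)).image (fun a => c s(a, b))
          ⊆ colsBetween c A (insert b B') := by
        intro x hx
        rcases Finset.mem_union.1 hx with hx | hx
        · rw [hK] at hx
          obtain ⟨p, hp, rfl⟩ := Finset.mem_image.1 hx
          refine Finset.mem_image.2 ⟨p, ?_, rfl⟩
          simp only [Finset.mem_product, Finset.mem_insert] at hp ⊢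
          exact ⟨hp.1, Or.inr hp.2⟩
        · obtain ⟨a, ha, rfl⟩ := Finset.mem_image.1 hx
          refine Finset.mem_image.2 ⟨(a, b), ?_, rfl⟩
          simp only [Finset.mem_product, Finset.mem_insert]
          exact ⟨(Finset.mem_filter.1 ha).1, Or.inl trivial⟩
      have hle := Finset.card_le_card hsub
      rw [Finset.card_union_of_disjoint, Finset.card_image_of_injOn] at hle
      · have := Finset.card_filter_add_card_filter_not (s := A) (fun a => c s(a, b) ∈ K)
        rw [hA] at this
        rw [add_mul]
        omega
      · intro a ha a2 ha2 heq
        have m1 := (Finset.mem_filter.1 ha).1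
        have m2 := (Finset.mem_filter.1 ha2).1
        refine hc b a a2 (hne a m1 b hb).symm (hne a2 m2 b hb).symm ?_
        simp only at heq
        rwa [Sym2.eq_swap, Sym2.eq_swap (a := b)]
      · rw [Finset.disjoint_right]
        intro x hx
        obtain ⟨a, ha, rfl⟩ := Finset.mem_image.1 hx
        exact (Finset.mem_filter.1 ha).2

/-- every set of size between 1 and s is the range of a function on `Fin s` -/
lemma exists_enum {n s : ℕ} (A : Finset (Fin n)) (hne : A.Nonempty) (hA : A.card ≤ s) :
    ∃ α : Fin s → Fin n, Finset.univ.image α = A := by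
  obtain ⟨a0, ha0⟩ := hne
  let e := A.equivFin
  refine ⟨fun i => if h : i.val < A.card then (e.symm ⟨i, h⟩).val else a0, ?_⟩
  ext x
  simp only [Finset.mem_image, Finset.mem_univ, true_and]
  constructor
  · rintro ⟨i, rfl⟩
    split_ifs with h
    · exact (e.symm ⟨i, h⟩).2
    · exact ha0
  · intro hx
    refine ⟨⟨(e ⟨x, hx⟩).val, lt_of_lt_of_le (e ⟨x, hx⟩).2 hA⟩, ?_⟩
    simp

/-- colors at a vertex -/
noncomputable def colsAt {n : ℕ} (c : Sym2 (Fin n) → ℕ) (v : Fin n) : Finset ℕ :=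
  (Finset.univ.erase v).image (fun u => c s(v, u))

/-- graph of the edges whose color satisfies `P` -/
def colGraph {n : ℕ} (c : Sym2 (Fin n) → ℕ) (P : ℕ → Prop) : SimpleGraph (Fin n) where
  Adj u v := u ≠ v ∧ P (c s(u, v))
  symm := ⟨fun u v h => ⟨h.1.symm, by rw [Sym2.eq_swap]; exact h.2⟩⟩
  loopless := ⟨fun u h => h.1 rfl⟩

lemma colGraph_mem {n : ℕ} (c : Sym2 (Fin n) → ℕ) (P : ℕ → Prop) (e : Sym2 (Fin n))
    (he : e ∈ (colGraph c P).edgeSet) : P (c e) := by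
  induction e with
  | _ u v => exact he.2

lemma colGraph_disj {n : ℕ} (c : Sym2 (Fin n) → ℕ) (P Q : ℕ → Prop) (h : ∀ x, P x → ¬ Q x) :
    Disjoint (colGraph c P).edgeSet (colGraph c Q).edgeSet ∧
      Disjoint (c '' (colGraph c P).edgeSet) (c '' (colGraph c Q).edgeSet) := by
  constructor
  · rw [Set.disjoint_left]
    intro e h1 h2
    exact h _ (colGraph_mem c P e h1) (colGraph_mem c Q e h2)
  · rw [Set.disjoint_left]
    rintro x ⟨e, h1, rfl⟩ ⟨e', h2, h3⟩
    refine h _ (colGraph_mem c P e h1) ?_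
    rw [← h3]
    exact colGraph_mem c Q e' h2

section
variable {n : ℕ} (c : Sym2 (Fin n) → ℕ)
    (hc : ∀ u v w : Fin n, u ≠ v → u ≠ w → c s(u, v) = c s(u, w) → v = w)

lemma colsAt_card
    (hc : ∀ u v w : Fin n, u ≠ v → u ≠ w → c s(u, v) = c s(u, w) → v = w) (v : Fin n) :
    (colsAt c v).card = n - 1 := by
  rw [colsAt, Finset.card_image_of_injOn]
  · rw [Finset.card_erase_of_mem (Finset.mem_univ _)]; simp
  · intro a ha b hb hab
    simp at ha hb
    exact hc v a b (Ne.symm ha) (Ne.symm hb) hab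

lemma degree_colGraph
    (hc : ∀ u v w : Fin n, u ≠ v → u ≠ w → c s(u, v) = c s(u, w) → v = w)
    (P : ℕ → Prop) [DecidablePred P] (v : Fin n) :
    ((colGraph c P).neighborSet v).ncard = ((colsAt c v).filter P).card := by
  have h1 : (colGraph c P).neighborSet v
      = ((Finset.univ.erase v).filter (fun u => P (c s(v, u))) : Finset (Fin n)) := by
    ext u
    simp [colGraph, eq_comm]
  rw [h1, Set.ncard_coe_finset, colsAt, Finset.filter_image, Finset.card_image_of_injOn]
  intro a ha b hb hab
  simp at ha hb
  exact hc v a b (Ne.symm ha.1) (Ne.symm hb.1) hab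
end

lemma numeric (n : ℕ) (x L : ℝ) (hx : x = Real.sqrt n) (hLn : L = Real.logb 2 n)
    (hL : 1 ≤ L) (hxL : 800 * L ≤ x) (F g : ℝ) (hF : F ≤ 2 * (n : ℝ) ^ (2 * ⌈x⌉₊)) (hg : g ≤ n)
    (a : ℕ) (ha : n ≤ 10 * a) :
    3 ≤ ⌊x / (200 * L)⌋₊ ∧
    (3 * F) * (2 ^ (2 * ⌈x⌉₊) * (1 - 1 / (2 * (⌊x / (200 * L)⌋₊ : ℝ))) ^ a)
      + g * ((1 + 3 / (⌊x / (200 * L)⌋₊ : ℝ)) ^ n / 2 ^ ⌈2600 * (x * L)⌉₊) < 1 := by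
  have hx0 : 800 ≤ x := by linarith
  have hL0 : 0 < L := by linarith
  have hxx : x * x = n := by rw [hx]; exact Real.mul_self_sqrt (by positivity)
  have hn0 : (0 : ℝ) < n := by rw [← hxx]; positivity
  have h4 : 4 ≤ x / (200 * L) := by rw [le_div_iff₀ (by positivity)]; linarith
  set M := ⌊x / (200 * L)⌋₊ with hM
  set s := ⌈x⌉₊ with hs
  have hM3 : 3 ≤ M := Nat.le_floor (by push_cast; linarith)
  refine ⟨hM3, ?_⟩
  have hM3' : (3 : ℝ) ≤ M := by exact_mod_cast hM3
  have hMu : (M : ℝ) ≤ x / (200 * L) := Nat.floor_le (by positivity)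
  have hMl : x / (400 * L) ≤ M := by
    have h1 := Nat.lt_floor_add_one (x / (200 * L))
    have h2 : x / (400 * L) = x / (200 * L) / 2 := by field_simp; norm_num
    rw [h2]
    rw [← hM] at h1
    linarith
  have hMu' : M * (200 * L) ≤ x := by rwa [le_div_iff₀ (by positivity)] at hMu
  have hMl' : x ≤ M * (400 * L) := by rwa [div_le_iff₀ (by positivity)] at hMl
  have hsu : (s : ℝ) ≤ x + 1 := (Nat.ceil_lt_add_one (by linarith)).le
  set Q := x * L with hQ
  have hQx : x ≤ Q := by rw [hQ]; nlinarith
  have hQL : 800 * L ≤ Q := by rw [hQ]; nlinarith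
  have hn2 : (n : ℝ) = 2 ^ L := by
    rw [hLn, Real.rpow_logb (by norm_num) (by norm_num) hn0]
  have hl1 : Real.log 2 ≤ 1 := by have := Real.log_two_lt_d9; linarith
  have hl2 : 1 / 2 ≤ Real.log 2 := by have := Real.log_two_gt_d9; linarith
  have two : ∀ y : ℝ, (2 : ℝ) ^ y = Real.exp (Real.log 2 * y) := fun y =>
    Real.rpow_def_of_pos (by norm_num) y
  -- first part
  have p1 : (1 - 1 / (2 * (M : ℝ))) ^ a ≤ (2 : ℝ) ^ (-(10 * Q)) := by
    have h0 : (0 : ℝ) ≤ 1 - 1 / (2 * M) := by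
      have : (1 : ℝ) / (2 * M) ≤ 1 := by
        rw [div_le_one (by positivity)]; linarith
      linarith
    have h1 : 1 - 1 / (2 * (M : ℝ)) ≤ Real.exp (-(1 / (2 * (M : ℝ)))) := by
      have := Real.add_one_le_exp (-(1 / (2 * (M : ℝ))))
      linarith
    refine (pow_le_pow_left₀ h0 h1 a).trans ?_
    rw [← Real.exp_nat_mul, two, Real.exp_le_exp]
    have h2 : 10 * Q ≤ a * (1 / (2 * (M : ℝ))) := by
      rw [mul_one_div, le_div_iff₀ (by positivity)]
      have ha' : (n : ℝ) ≤ 10 * a := by exact_mod_cast ha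
      have : x * (M * (200 * L)) ≤ x * x := by gcongr
      rw [hQ]
      nlinarith
    have h3 : Real.log 2 * (10 * Q) ≤ 10 * Q := by nlinarith
    linarith
  have p2 : (n : ℝ) ^ (2 * s) * 2 ^ (2 * s) ≤ (2 : ℝ) ^ (8 * Q) := by
    rw [hn2, ← Real.rpow_natCast, ← Real.rpow_natCast, ← Real.rpow_mul (by norm_num),
      ← Real.rpow_add (by norm_num)]
    apply Real.rpow_le_rpow_of_exponent_le (by norm_num)
    push_cast
    have : (1 + L) * (2 * s) ≤ (2 * L) * (2 * (2 * x)) := by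
      gcongr
      · linarith
      · linarith
    rw [hQ]
    nlinarith
  have q1 : (2 : ℝ) ^ (-(2 * Q)) ≤ 1 / 16 := by
    have : (2 : ℝ) ^ (-(2 * Q)) ≤ 2 ^ (-4 : ℝ) :=
      Real.rpow_le_rpow_of_exponent_le (by norm_num) (by linarith)
    refine this.trans ?_
    rw [Real.rpow_neg (by norm_num)]
    norm_num
  have P1 : (3 * F) * (2 ^ (2 * s) * (1 - 1 / (2 * (M : ℝ))) ^ a) ≤ 6 / 16 := by
    have h0 : (0 : ℝ) ≤ 1 - 1 / (2 * M) := by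
      have : (1 : ℝ) / (2 * M) ≤ 1 := by
        rw [div_le_one (by positivity)]; linarith
      linarith
    calc (3 * F) * (2 ^ (2 * s) * (1 - 1 / (2 * (M : ℝ))) ^ a)
        ≤ (3 * (2 * (n : ℝ) ^ (2 * s))) * (2 ^ (2 * s) * (1 - 1 / (2 * (M : ℝ))) ^ a) := by gcongr
      _ = 6 * (((n : ℝ) ^ (2 * s) * 2 ^ (2 * s)) * (1 - 1 / (2 * (M : ℝ))) ^ a) := by ring
      _ ≤ 6 * ((2 : ℝ) ^ (8 * Q) * (2 : ℝ) ^ (-(10 * Q))) := by gcongr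
      _ = 6 * (2 : ℝ) ^ (-(2 * Q)) := by
          rw [← Real.rpow_add (by norm_num)]; congr 2; ring
      _ ≤ 6 / 16 := by linarith
  -- second part
  have p3 : (1 + 3 / (M : ℝ)) ^ n ≤ (2 : ℝ) ^ (2400 * Q) := by
    have h1 : 1 + 3 / (M : ℝ) ≤ Real.exp (3 / (M : ℝ)) := by
      have := Real.add_one_le_exp (3 / (M : ℝ))
      linarith
    refine (pow_le_pow_left₀ (by positivity) h1 n).trans ?_
    rw [← Real.exp_nat_mul, two, Real.exp_le_exp]
    have h2 : n * (3 / (M : ℝ)) ≤ 1200 * Q := by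
      rw [← mul_div_assoc, div_le_iff₀ (by positivity)]
      have : x * x ≤ x * (M * (400 * L)) := by gcongr
      rw [hQ]
      nlinarith
    nlinarith
  have p4 : (2 : ℝ) ^ (2600 * Q) ≤ 2 ^ ⌈2600 * Q⌉₊ := by
    rw [← Real.rpow_natCast]
    exact Real.rpow_le_rpow_of_exponent_le (by norm_num) (Nat.le_ceil _)
  have P2 : g * ((1 + 3 / (M : ℝ)) ^ n / 2 ^ ⌈2600 * Q⌉₊) ≤ 1 / 2 := by
    calc g * ((1 + 3 / (M : ℝ)) ^ n / 2 ^ ⌈2600 * Q⌉₊)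
        ≤ (2 : ℝ) ^ L * ((2 : ℝ) ^ (2400 * Q) / (2 : ℝ) ^ (2600 * Q)) := by
          rw [← hn2]
          gcongr
      _ = (2 : ℝ) ^ (L + (2400 * Q - 2600 * Q)) := by
          rw [Real.rpow_add (by norm_num), Real.rpow_sub (by norm_num)]
      _ ≤ (2 : ℝ) ^ (-1 : ℝ) :=
          Real.rpow_le_rpow_of_exponent_le (by norm_num) (by linarith)
      _ = 1 / 2 := by rw [Real.rpow_neg_one]; norm_num
  linarith

lemma removeColors_colGraph {n : ℕ} (c : Sym2 (Fin n) → ℕ) (P : ℕ → Prop) (S : Finset ℕ) :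
    removeColors (colGraph c P) c S = colGraph c (fun k => P k ∧ k ∉ S) := by
  ext u v
  simp only [removeColors, SimpleGraph.fromEdgeSet_adj, Set.mem_ofPred_eq,
    SimpleGraph.mem_edgeSet, colGraph]
  tauto

lemma filter_survive (K S : Finset ℕ) (P : ℕ → Prop) :
    (K.filter P).card ≤ (K.filter (fun k => P k ∧ k ∉ S)).card + S.card := by
  have : K.filter P ⊆ K.filter (fun k => P k ∧ k ∉ S) ∪ S := by
    intro k hk
    simp only [Finset.mem_union, Finset.mem_filter] at hk ⊢
    tauto
  exact (Finset.card_le_card this).trans (Finset.card_union_le _ _)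

lemma expander_of {n : ℕ} (c : Sym2 (Fin n) → ℕ)
    (hc : ∀ u v w : Fin n, u ≠ v → u ≠ w → c s(u, v) = c s(u, w) → v = w)
    (hn : 20 ≤ n) (P : ℕ → Prop)
    (h1 : ∀ v, 2 * ⌈Real.sqrt n⌉₊ < ((colsAt c v).filter P).card)
    (h2 : ∀ A B : Finset (Fin n), Disjoint A B → A.card = ⌈Real.sqrt n⌉₊ → n ≤ 5 * B.card →
      ∃ B' ⊆ B, 2 * ⌈Real.sqrt n⌉₊ < ((colsBetween c A B').filter P).card)
    (S : Finset ℕ) (hS : (S.card : ℝ) ≤ Real.sqrt n) :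
    IsExpander (removeColors (colGraph c P) c S) (Real.sqrt n) ((n : ℝ) / 4) := by
  rw [removeColors_colGraph]
  have hs := Nat.le_ceil (Real.sqrt n)
  have hs2 := Nat.ceil_lt_add_one (Real.sqrt_nonneg n)
  set s := ⌈Real.sqrt n⌉₊ with hsdef
  have hS' : S.card ≤ s := by exact_mod_cast hS.trans hs
  have hn' : (20 : ℝ) ≤ n := by exact_mod_cast hn
  have key : ∀ A B : Finset (Fin n), Disjoint A B → A.card = s → n ≤ 5 * B.card →
      ∃ u ∈ A, ∃ v ∈ B, (colGraph c (fun k => P k ∧ k ∉ S)).Adj u v := by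
    intro A B hAB hA hB
    obtain ⟨B', hB', hlt⟩ := h2 A B hAB hA hB
    have h3 := filter_survive (colsBetween c A B') S P
    have h4 : 0 < ((colsBetween c A B').filter (fun k => P k ∧ k ∉ S)).card := by omega
    obtain ⟨k, hk⟩ := Finset.card_pos.1 h4
    obtain ⟨hk1, hk2⟩ := Finset.mem_filter.1 hk
    obtain ⟨p, hp, rfl⟩ := Finset.mem_image.1 hk1
    rw [Finset.mem_product] at hp
    refine ⟨p.1, hp.1, p.2, hB' hp.2, ?_, hk2⟩
    intro h
    exact Finset.disjoint_left.1 hAB hp.1 (h ▸ hB' hp.2)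
  refine ⟨?_, ?_, ?_⟩
  · intro v
    rw [degree_colGraph c hc]
    have h3 := filter_survive (colsAt c v) S P
    have h4 := h1 v
    have h5 : s ≤ ((colsAt c v).filter (fun k => P k ∧ k ∉ S)).card := by omega
    exact hs.trans (by exact_mod_cast h5)
  · intro A hA
    have hA' : s ≤ A.card := Nat.ceil_le.2 hA
    obtain ⟨A', hA'A, hA'c⟩ := Finset.exists_subset_card_eq hA'
    by_contra hcon
    push Not at hcon
    set Ns := ⋃ u ∈ (A : Set (Fin n)), (colGraph c (fun k => P k ∧ k ∉ S)).neighborSet u with hNs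
    rw [Set.ncard_eq_toFinset_card'] at hcon
    rw [Fintype.card_fin] at hcon
    let B := Finset.univ \ (A' ∪ Ns.toFinset)
    have hBc : n ≤ B.card + (s + Ns.toFinset.card) := by
      have e1 := Finset.card_sdiff_add_card_eq_card (Finset.subset_univ (A' ∪ Ns.toFinset))
      have e2 := Finset.card_union_le A' Ns.toFinset
      rw [Finset.card_univ, Fintype.card_fin] at e1
      simp only [B]
      omega
    have hBc' : (n : ℝ) ≤ B.card + (s + Ns.toFinset.card) := by exact_mod_cast hBc
    have hB5 : n ≤ 5 * B.card := by
      have : (n : ℝ) ≤ 5 * B.card := by linarith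
      exact_mod_cast this
    obtain ⟨u, hu, v, hv, hadj⟩ := key A' B (by
      rw [Finset.disjoint_left]
      intro y hy hyB
      simp only [B, Finset.mem_sdiff, Finset.mem_union] at hyB
      exact hyB.2 (Or.inl hy)) hA'c hB5
    simp only [B, Finset.mem_sdiff, Finset.mem_union, Set.mem_toFinset] at hv
    refine hv.2 (Or.inr ?_)
    rw [hNs]
    simp only [Set.mem_iUnion]
    exact ⟨u, hA'A hu, hadj⟩
  · intro A B hAB hA hB
    have hA' : s ≤ A.card := Nat.ceil_le.2 hA
    obtain ⟨A', hA'A, hA'c⟩ := Finset.exists_subset_card_eq hA'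
    have hB5 : n ≤ 5 * B.card := by
      have : (n : ℝ) ≤ 5 * B.card := by linarith
      exact_mod_cast this
    obtain ⟨u, hu, v, hv, hadj⟩ := key A' B (Finset.disjoint_of_subset_left hA'A hAB) hA'c hB5
    exact ⟨u, hA'A hu, v, hv, hadj⟩

lemma large_n : ∃ N : ℕ, ∀ n : ℕ, N ≤ n → 1 ≤ Real.logb 2 n ∧ 20 ≤ n ∧
    800 * Real.logb 2 n ≤ Real.sqrt n := by
  have h := (isLittleO_log_rpow_atTop (r := 1/2) (by norm_num)).bound
    (c := Real.log 2 / 800) (by have := Real.log_pos (x := 2) (by norm_num); positivity)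
  have h' := (tendsto_natCast_atTop_atTop (R := ℝ)).eventually h
  obtain ⟨N, hN⟩ := Filter.eventually_atTop.1 h'
  refine ⟨max N 20, fun n hn => ?_⟩
  have h20 : 20 ≤ n := le_trans (le_max_right _ _) hn
  have hn' : (20 : ℝ) ≤ n := by exact_mod_cast h20
  have hl := hN n (le_trans (le_max_left _ _) hn)
  have hpos := Real.log_pos (x := 2) (by norm_num)
  refine ⟨?_, h20, ?_⟩
  · rw [Real.le_logb_iff_rpow_le (by norm_num) (by linarith)]
    norm_num; linarith
  · rw [Real.norm_of_nonneg (Real.log_nonneg (by linarith)), Real.norm_of_nonneg (by positivity),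
      ← Real.sqrt_eq_rpow] at hl
    rw [Real.logb, ← mul_div_assoc, div_le_iff₀ hpos]
    linarith

/-- There is a constant `C` such that for all sufficiently large `n` the following holds.
Let `G₁` be a properly edge-colored complete graph on `n` vertices and set
`p = C log₂ n / √n`, `a = √n`, `b = n/4` and `δ = 4p`.  Then there are edge-disjoint
spanning subgraphs `G, H₁, H₂, H₃` of `G₁`, colored (by restriction) with pairwise disjoint
sets of colors, such that (a) `G` has minimum degree at least `(1 - δ)n`, and (b) for every
`m ≤ √n` and each `i`, removing any `m` color classes from `Hᵢ` yields an
`(a,b)`-expander. -/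
theorem expander_decomposition :
    ∃ C : ℝ, ∃ N : ℕ, ∀ n : ℕ, N ≤ n → ∀ c : Sym2 (Fin n) → ℕ,
      IsProperEdgeColoring (⊤ : SimpleGraph (Fin n)) c →
      ∃ G H₁ H₂ H₃ : SimpleGraph (Fin n),
        ([G, H₁, H₂, H₃] : List (SimpleGraph (Fin n))).Pairwise
          (fun X Y => Disjoint X.edgeSet Y.edgeSet ∧
            Disjoint (c '' X.edgeSet) (c '' Y.edgeSet)) ∧
        (∀ v, (1 - 4 * (C * Real.logb 2 n / Real.sqrt n)) * (n : ℝ) ≤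
          ((G.neighborSet v).ncard : ℝ)) ∧
        (∀ H' ∈ ([H₁, H₂, H₃] : List (SimpleGraph (Fin n))), ∀ m : ℕ,
          (m : ℝ) ≤ Real.sqrt n → ∀ S : Finset ℕ, S.card = m →
            IsExpander (removeColors H' c S) (Real.sqrt n) ((n : ℝ) / 4)) := by
  obtain ⟨N, hN⟩ := large_n
  refine ⟨700, N, fun n hn c hproper => ?_⟩
  obtain ⟨hL, h20, hxL⟩ := hN n hn
  have hc : ∀ u v w : Fin n, u ≠ v → u ≠ w → c s(u, v) = c s(u, w) → v = w := by
    intro u v w huv huw heq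
    by_contra hvw
    refine hproper (e₁ := s(u, v)) (e₂ := s(u, w)) ?_ ?_ ?_ ⟨u, by simp, by simp⟩ heq
    · simpa using huv
    · simpa using huw
    · intro h
      rw [Sym2.congr_right] at h
      exact hvw h
  set x := Real.sqrt n with hx
  set L := Real.logb 2 n with hLdef
  set s := ⌈x⌉₊ with hs
  have hxx : x * x = n := by rw [hx]; exact Real.mul_self_sqrt (by positivity)
  have hx0 : 800 ≤ x := by linarith
  have hs1 : 1 ≤ s := Nat.one_le_ceil_iff.2 (by linarith)
  have hss : n ≤ s * s := by
    have h1 := Nat.le_ceil x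
    have : (n : ℝ) ≤ s * s := by rw [← hxx]; gcongr
    exact_mod_cast this
  let FF : Finset (Finset ℕ) := Finset.univ.image (colsAt c) ∪
    ((Finset.univ.image (fun p : (Fin s → Fin n) × (Fin s → Fin n) =>
      colsBetween c (Finset.univ.image p.1) (Finset.univ.image p.2))).filter
        (fun K => n ≤ 10 * K.card))
  let GG : Finset (Finset ℕ) := Finset.univ.image (colsAt c)
  have hGGc : GG.card ≤ n := by
    refine Finset.card_image_le.trans ?_
    simp
  have hFFc : FF.card ≤ 2 * n ^ (2 * s) := by
    have e1 : FF.card ≤ n + n ^ s * n ^ s := by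
      refine (Finset.card_union_le _ _).trans (add_le_add hGGc ?_)
      refine (Finset.card_filter_le _ _).trans (Finset.card_image_le.trans ?_)
      simp
    have e2 : n ≤ n ^ (2 * s) := Nat.le_self_pow (by omega) n
    have e3 : n ^ s * n ^ s = n ^ (2 * s) := by rw [← pow_add, two_mul]
    omega
  obtain ⟨hM3, hsum⟩ := numeric n x L hx hLdef hL hxL (FF.card) (GG.card)
    (by exact_mod_cast hFFc) (by exact_mod_cast hGGc) ((n + 9) / 10) (by omega)
  obtain ⟨f, hf1, hf2⟩ := exists_good_nat hM3 FF GG (2 * s) ⌈2600 * (x * L)⌉₊ ((n + 9) / 10) n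
    (by
      intro K hK
      rcases Finset.mem_union.1 hK with hK | hK
      · obtain ⟨v, -, rfl⟩ := Finset.mem_image.1 hK
        rw [colsAt_card c hc]; omega
      · have := (Finset.mem_filter.1 hK).2
        omega)
    (by
      intro K hK
      obtain ⟨v, -, rfl⟩ := Finset.mem_image.1 hK
      rw [colsAt_card c hc]; omega) hsum
  have hexp : ∀ i < 3, ∀ S : Finset ℕ, (S.card : ℝ) ≤ x →
      IsExpander (removeColors (colGraph c (fun k => f k = i)) c S) x ((n : ℝ) / 4) := by
    intro i hi S hS
    refine expander_of c hc h20 _ ?_ ?_ S hS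
    · intro v
      have := hf1 (colsAt c v) (Finset.mem_union_left _
        (Finset.mem_image_of_mem _ (Finset.mem_univ v))) i hi
      convert this
    · intro A B hAB hA hB
      obtain ⟨B', hB', hcard, h⟩ := greedy c hc A B hAB hA hB s
      have hK : n ≤ 10 * (colsBetween c A B').card := by
        rcases h with h | h
        · exact h
        · have h' : s * s ≤ 2 * (colsBetween c A B').card := h
          omega
      have hBne : B'.Nonempty := by
        rw [Finset.nonempty_iff_ne_empty]
        rintro rfl
        simp [colsBetween] at hK
        omega
      have hAne : A.Nonempty := by
        rw [← Finset.card_pos, hA]; exact hs1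
      obtain ⟨α, hα⟩ := exists_enum A hAne hA.le
      obtain ⟨β, hβ⟩ := exists_enum B' hBne hcard
      refine ⟨B', hB', ?_⟩
      have := hf1 (colsBetween c A B') (Finset.mem_union_right _ (Finset.mem_filter.2
        ⟨Finset.mem_image.2 ⟨(α, β), Finset.mem_univ _, by simp only [hα, hβ]⟩, hK⟩)) i hi
      convert this
  refine ⟨colGraph c (fun k => ¬ f k < 3), colGraph c (fun k => f k = 0),
    colGraph c (fun k => f k = 1), colGraph c (fun k => f k = 2), ?_, ?_, ?_⟩
  · simp only [List.pairwise_cons, List.mem_cons, List.not_mem_nil, or_false, forall_eq_or_imp,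
      forall_eq, List.Pairwise.nil, and_true, IsEmpty.forall_iff, implies_true]
    refine ⟨⟨?_, ?_, ?_⟩, ⟨?_, ?_⟩, ?_⟩ <;>
      exact colGraph_disj c _ _ (fun k h1 h2 => by omega)
  · intro v
    rw [degree_colGraph c hc]
    have h1 := hf2 (colsAt c v) (Finset.mem_image_of_mem _ (Finset.mem_univ v))
    have h2 := Nat.lt_ceil.1 h1
    have h3 := Finset.card_filter_add_card_filter_not (s := colsAt c v) (fun k => f k < 3)
    rw [colsAt_card c hc] at h3
    have h4 : (n : ℝ) = ((colsAt c v).filter (fun k => f k < 3)).card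
        + ((colsAt c v).filter (fun k => ¬ f k < 3)).card + 1 := by
      have : n = ((colsAt c v).filter (fun k => f k < 3)).card
        + ((colsAt c v).filter (fun k => ¬ f k < 3)).card + 1 := by omega
      exact_mod_cast this
    have h5 : (1 - 4 * (700 * L / x)) * (n : ℝ) = n - 2800 * (x * L) := by
      rw [← hxx]; field_simp; ring
    rw [h5]
    have h6 : 1 ≤ x * L := by nlinarith
    linarith
  · intro H' hH' m hm S hS
    have hS' : (S.card : ℝ) ≤ x := by rw [hS]; exact hm
    simp only [List.mem_cons, List.not_mem_nil, or_false] at hH'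
    rcases hH' with rfl | rfl | rfl
    · exact hexp 0 (by norm_num) S hS'
    · exact hexp 1 (by norm_num) S hS'
    · exact hexp 2 (by norm_num) S hS'
end

section
/- Fix ε > 0 small and y a positive integer, and let G be a properly edge-colored graph on vertex sets A and B, disjoint, of sizes a and b with y ≤ a ≤ b, such that every vertex of A has at least b - δn non-neighbors missing toward B for δn satisfying |E(A,B)| ≥ ab - aδn, and suppose (y-1)^2/(2(b-1)) ≤ ε^2/2 and δn/b ≤ ε^2/2. If S and T are chosen uniformly at random from the y-element subsets of A and of B respectively, then the expected number Z of distinct colors appearing on the edges of G between S and T satisfies E(Z) ≥ (1 - ε^2) y^2, and consequently the probability that the pair (S,T) is ε-nearly-rainbow is at least 1 - ε. -/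
open scoped Classical

/-- `eBetween G A B` is the number of edges of `G` with one endpoint in `A` and the other
endpoint in `B`. -/
noncomputable def eBetween {V : Type*} (G : SimpleGraph V) (A B : Finset V) : ℕ :=
  {e : Sym2 V | e ∈ G.edgeSet ∧ ∃ u ∈ A, ∃ v ∈ B, e = s(u, v)}.ncard

/-- `colorsBetween G c A B` is the number of distinct colors appearing on the edges of `G`
with one endpoint in `A` and the other endpoint in `B`. -/
noncomputable def colorsBetween {V : Type*} (G : SimpleGraph V) (c : Sym2 V → ℕ)
    (A B : Finset V) : ℕ :=
  (c '' {e : Sym2 V | e ∈ G.edgeSet ∧ ∃ u ∈ A, ∃ v ∈ B, e = s(u, v)}).ncard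

/-- A pair of disjoint vertex sets `S`, `T` is `ε`-nearly-rainbow if at least
`(1 - ε)|S||T|` distinct colors appear on the edges of `G` between `S` and `T`. -/
def NearlyRainbow {V : Type*} (ε : ℝ) (G : SimpleGraph V) (c : Sym2 V → ℕ)
    (S T : Finset V) : Prop :=
  (1 - ε) * S.card * T.card ≤ (colorsBetween G c S T : ℝ)

lemma ecrs_count {V : Type*} (A P : Finset V) (y : ℕ) (hP : P ⊆ A) :
    ((A.powersetCard y).filter (fun S => P ⊆ S)).card * A.card.choose P.card
      = A.card.choose y * y.choose P.card := by
  by_cases h : P.card ≤ y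
  · rw [Nat.choose_mul h]
    have := Finset.card_filter_powersetCard_subset P A y hP h
    rw [mul_comm]
    congr 1
  · have h' : y < P.card := not_le.mp h
    rw [Nat.choose_eq_zero_of_lt h', mul_zero, Finset.filter_false_of_mem, Finset.card_empty,
      zero_mul]
    intro S hS hPS
    have := Finset.card_le_card hPS
    rw [Finset.mem_powersetCard] at hS
    omega

lemma ecrs_double {V X : Type*} (A B : Finset V) (y s : ℕ) (E : Finset X) (P Q : X → Finset V)
    (hP : ∀ x ∈ E, P x ⊆ A ∧ (P x).card = s) (hQ : ∀ x ∈ E, Q x ⊆ B ∧ (Q x).card = s) :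
    (∑ q ∈ A.powersetCard y ×ˢ B.powersetCard y,
      (E.filter (fun x => P x ⊆ q.1 ∧ Q x ⊆ q.2)).card) * (A.card.choose s * B.card.choose s)
    = E.card * ((A.card.choose y * B.card.choose y) * (y.choose s) ^ 2) := by
  have h := Finset.sum_card_bipartiteAbove_eq_sum_card_bipartiteBelow
    (s := A.powersetCard y ×ˢ B.powersetCard y) (t := E)
    (fun (q : Finset V × Finset V) x => P x ⊆ q.1 ∧ Q x ⊆ q.2)
  unfold Finset.bipartiteAbove Finset.bipartiteBelow at h
  rw [h, Finset.sum_mul, ← smul_eq_mul (a := E.card)]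
  apply Finset.sum_eq_card_nsmul
  intro x hx
  have e : ((A.powersetCard y ×ˢ B.powersetCard y).filter
      (fun q => P x ⊆ q.1 ∧ Q x ⊆ q.2)).card =
      ((A.powersetCard y).filter (fun S => P x ⊆ S)).card *
      ((B.powersetCard y).filter (fun S => Q x ⊆ S)).card := by
    rw [← Finset.card_product]
    congr 1
    ext q
    simp only [Finset.mem_filter, Finset.mem_product]
    tauto
  rw [e]
  have h1 := ecrs_count A (P x) y (hP x hx).1
  have h2 := ecrs_count B (Q x) y (hQ x hx).1
  rw [(hP x hx).2] at h1
  rw [(hQ x hx).2] at h2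
  rw [mul_mul_mul_comm, h1, h2]
  ring

lemma ecrs_fiber {X : Type*} (F : Finset X) (f : X → ℕ) :
    2 * F.card ≤ 2 * (F.image f).card +
      ((F ×ˢ F).filter (fun x => x.1 ≠ x.2 ∧ f x.1 = f x.2)).card := by
  have h1 := Finset.card_eq_sum_card_image f F
  have h2 : ((F ×ˢ F).filter (fun x => x.1 ≠ x.2 ∧ f x.1 = f x.2)).card =
      ∑ k ∈ F.image f, ((F.filter (fun x => f x = k)).offDiag).card := by
    rw [Finset.card_eq_sum_card_fiberwise (f := fun x : X × X => f x.1) (t := F.image f)]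
    · apply Finset.sum_congr rfl
      intro k hk
      congr 1
      ext x
      simp only [Finset.mem_filter, Finset.mem_product, Finset.mem_offDiag]
      constructor
      · rintro ⟨⟨⟨a1, a2⟩, a3, a4⟩, a5⟩
        exact ⟨⟨a1, a5⟩, ⟨a2, a4 ▸ a5⟩, a3⟩
      · rintro ⟨⟨a1, a5⟩, ⟨a2, a4⟩, a3⟩
        exact ⟨⟨⟨a1, a2⟩, a3, a5.trans a4.symm⟩, a5⟩
    · intro x hx
      simp only [Finset.coe_filter, Finset.mem_product, Set.mem_setOf_eq] at hx
      exact Finset.mem_coe.2 (Finset.mem_image_of_mem f hx.1.1)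
  rw [h2, h1, Finset.card_eq_sum_ones, Finset.mul_sum, Finset.mul_sum, ← Finset.sum_add_distrib]
  apply Finset.sum_le_sum
  intro k hk
  rw [Finset.offDiag_card]
  generalize (F.filter (fun x => f x = k)).card = m
  rcases m with _ | _ | m
  · simp
  · simp
  · have : (m + 1 + 1) * (m + 1 + 1) - (m + 1 + 1) = (m + 2) * (m + 1) := by
      rw [Nat.sub_eq_iff_eq_add (by nlinarith)]; ring
    rw [this]; nlinarith

/-- The edges between `A` and `B` as ordered pairs. -/
noncomputable def ecrsE {V : Type*} (G : SimpleGraph V) (A B : Finset V) : Finset (V × V) :=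
  (A ×ˢ B).filter (fun p => G.Adj p.1 p.2)

lemma ecrs_set {V : Type*} (G : SimpleGraph V) (A B : Finset V) :
    {e : Sym2 V | e ∈ G.edgeSet ∧ ∃ u ∈ A, ∃ v ∈ B, e = s(u, v)} =
      ((ecrsE G A B).image (fun p => s(p.1, p.2)) : Finset (Sym2 V)) := by
  ext e
  simp only [Set.mem_setOf_eq, ecrsE, Finset.coe_image, Finset.coe_filter, Finset.mem_product,
    Set.mem_image, Prod.exists]
  constructor
  · rintro ⟨h, u, hu, v, hv, rfl⟩
    exact ⟨u, v, ⟨⟨hu, hv⟩, h⟩, rfl⟩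
  · rintro ⟨u, v, ⟨⟨hu, hv⟩, h⟩, rfl⟩
    exact ⟨h, u, hu, v, hv, rfl⟩

lemma ecrs_eBetween {V : Type*} (G : SimpleGraph V) (A B : Finset V) :
    eBetween G A B ≤ (ecrsE G A B).card := by
  unfold eBetween
  rw [ecrs_set, Set.ncard_coe_finset]
  exact Finset.card_image_le

lemma ecrs_colors {V : Type*} (G : SimpleGraph V) (c : Sym2 V → ℕ) (A B : Finset V) :
    colorsBetween G c A B = ((ecrsE G A B).image (fun p => c s(p.1, p.2))).card := by
  unfold colorsBetween
  rw [ecrs_set, ← Finset.coe_image, Set.ncard_coe_finset, Finset.image_image]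
  rfl

lemma ecrs_colors_le {V : Type*} (G : SimpleGraph V) (c : Sym2 V → ℕ) (A B : Finset V) :
    colorsBetween G c A B ≤ A.card * B.card := by
  rw [ecrs_colors, ← Finset.card_product]
  exact Finset.card_image_le.trans (Finset.card_le_card (Finset.filter_subset _ _))

/-- Ordered pairs of distinct edges of the same color. -/
noncomputable def ecrsM {V : Type*} (G : SimpleGraph V) (c : Sym2 V → ℕ) (A B : Finset V) :
    Finset ((V × V) × (V × V)) :=
  ((ecrsE G A B) ×ˢ (ecrsE G A B)).filter
    (fun x => x.1 ≠ x.2 ∧ c s(x.1.1, x.1.2) = c s(x.2.1, x.2.2))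

lemma ecrs_inj {V : Type*} (G : SimpleGraph V) (c : Sym2 V → ℕ) (A B : Finset V)
    (hproper : IsProperEdgeColoring G c) (hAB : Disjoint A B) {p q : V × V}
    (hp : p ∈ ecrsE G A B) (hq : q ∈ ecrsE G A B)
    (hc : c s(p.1, p.2) = c s(q.1, q.2)) (h : p.1 = q.1 ∨ p.2 = q.2) : p = q := by
  obtain ⟨u, v⟩ := p
  obtain ⟨u', v'⟩ := q
  simp only [ecrsE, Finset.mem_filter, Finset.mem_product] at *
  by_contra hne
  refine hproper (e₁ := s(u, v)) (e₂ := s(u', v')) hp.2 hq.2 ?_ ?_ hc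
  · intro he
    rw [Sym2.eq_iff] at he
    rcases he with ⟨rfl, rfl⟩ | ⟨rfl, rfl⟩
    · exact hne rfl
    · exact Finset.disjoint_left.1 hAB hp.1.1 hq.1.2
  · rcases h with rfl | rfl
    · exact ⟨u, by simp, by simp⟩
    · exact ⟨v, by simp, by simp⟩

lemma ecrs_M_mem {V : Type*} (G : SimpleGraph V) (c : Sym2 V → ℕ) (A B : Finset V)
    (hproper : IsProperEdgeColoring G c) (hAB : Disjoint A B) {x : (V × V) × (V × V)}
    (hx : x ∈ ecrsM G c A B) : x.1.1 ∈ A ∧ x.1.2 ∈ B ∧ x.2.1 ∈ A ∧ x.2.2 ∈ B ∧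
      x.1.1 ≠ x.2.1 ∧ x.1.2 ≠ x.2.2 := by
  simp only [ecrsM, Finset.mem_filter, Finset.mem_product] at hx
  obtain ⟨⟨h1, h2⟩, h3, h4⟩ := hx
  have h1' := h1
  have h2' := h2
  simp only [ecrsE, Finset.mem_filter, Finset.mem_product] at h1' h2'
  refine ⟨h1'.1.1, h1'.1.2, h2'.1.1, h2'.1.2, ?_, ?_⟩
  · intro h; exact h3 (ecrs_inj G c A B hproper hAB h1 h2 h4 (Or.inl h))
  · intro h; exact h3 (ecrs_inj G c A B hproper hAB h1 h2 h4 (Or.inr h))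

lemma ecrs_M_card {V : Type*} (G : SimpleGraph V) (c : Sym2 V → ℕ) (A B : Finset V)
    (hproper : IsProperEdgeColoring G c) (hAB : Disjoint A B) :
    (ecrsM G c A B).card ≤ B.card * (A.card * A.card - A.card) := by
  rw [← Finset.offDiag_card, ← Finset.card_product]
  apply Finset.card_le_card_of_injOn (fun x => (x.1.2, (x.1.1, x.2.1)))
  · intro x hx
    have := ecrs_M_mem G c A B hproper hAB hx
    simp only [Finset.coe_product, Set.mem_prod, Finset.mem_coe, Finset.mem_offDiag]
    tauto
  · intro x hx z hz h
    simp only [Prod.mk.injEq] at h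
    obtain ⟨h1, h2, h3⟩ := h
    simp only [ecrsM, Finset.mem_coe, Finset.mem_filter, Finset.mem_product] at hx hz
    have e1 : x.1 = z.1 := Prod.ext h2 h1
    have e2 : x.2 = z.2 := by
      refine ecrs_inj G c A B hproper hAB hx.1.2 hz.1.2 ?_ (Or.inl h3)
      rw [← hx.2.2, ← hz.2.2, e1]
    exact Prod.ext e1 e2

lemma ecrs_point {V : Type*} (G : SimpleGraph V) (c : Sym2 V → ℕ) (A B S T : Finset V)
    (hS : S ⊆ A) (hT : T ⊆ B) :
    2 * ((ecrsE G A B).filter (fun p => {p.1} ⊆ S ∧ {p.2} ⊆ T)).card ≤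
      2 * colorsBetween G c S T +
      ((ecrsM G c A B).filter (fun x => {x.1.1, x.2.1} ⊆ S ∧ {x.1.2, x.2.2} ⊆ T)).card := by
  have h := ecrs_fiber (ecrsE G S T) (fun p => c s(p.1, p.2))
  rw [ecrs_colors]
  have e1 : (ecrsE G A B).filter (fun p => {p.1} ⊆ S ∧ {p.2} ⊆ T) = ecrsE G S T := by
    ext p
    simp only [ecrsE, Finset.mem_filter, Finset.mem_product, Finset.singleton_subset_iff]
    have := @hS p.1
    have := @hT p.2
    tauto
  rw [e1]
  refine h.trans (Nat.add_le_add_left (Finset.card_le_card ?_) _)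
  intro x hx
  simp only [ecrsM, ecrsE, Finset.mem_filter, Finset.mem_product, Finset.insert_subset_iff,
    Finset.singleton_subset_iff] at hx ⊢
  have := @hS x.1.1
  have := @hT x.1.2
  have := @hS x.2.1
  have := @hT x.2.2
  tauto

lemma ecrs_choose_two (n : ℕ) : (2 : ℝ) * (n.choose 2 : ℝ) = n * (n - 1) := by
  rw [Nat.cast_choose_two]; ring

lemma ecrs_expect
    {V : Type*} (ε : ℝ) (y : ℕ) (hy : 0 < y)
    (G : SimpleGraph V) (c : Sym2 V → ℕ) (A B : Finset V) (a b : ℕ) (δn : ℝ)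
    (hproper : IsProperEdgeColoring G c)
    (hAB : Disjoint A B) (hA : A.card = a) (hB : B.card = b)
    (hya : y ≤ a) (hab : a ≤ b)
    (hE : (a : ℝ) * (b : ℝ) - (a : ℝ) * δn ≤ (eBetween G A B : ℝ))
    (h1 : ((y : ℝ) - 1) ^ 2 / (2 * ((b : ℝ) - 1)) ≤ ε ^ 2 / 2)
    (h2 : δn / (b : ℝ) ≤ ε ^ 2 / 2) :
    (1 - ε ^ 2) * (y : ℝ) ^ 2 * ((a.choose y : ℝ) * b.choose y) ≤
      ∑ q ∈ A.powersetCard y ×ˢ B.powersetCard y, (colorsBetween G c q.1 q.2 : ℝ) := by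
  have d1 := ecrs_double A B y 1 (ecrsE G A B) (fun p => {p.1}) (fun p => {p.2})
    (by
      intro x hx
      simp only [ecrsE, Finset.mem_filter, Finset.mem_product] at hx
      exact ⟨by simpa using hx.1.1, by simp⟩)
    (by
      intro x hx
      simp only [ecrsE, Finset.mem_filter, Finset.mem_product] at hx
      exact ⟨by simpa using hx.1.2, by simp⟩)
  have d2 := ecrs_double A B y 2 (ecrsM G c A B) (fun x => {x.1.1, x.2.1})
    (fun x => {x.1.2, x.2.2})
    (by
      intro x hx
      obtain ⟨k1, k2, k3, k4, k5, k6⟩ := ecrs_M_mem G c A B hproper hAB hx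
      refine ⟨?_, Finset.card_pair k5⟩
      simp only [Finset.insert_subset_iff, Finset.singleton_subset_iff]
      exact ⟨k1, k3⟩)
    (by
      intro x hx
      obtain ⟨k1, k2, k3, k4, k5, k6⟩ := ecrs_M_mem G c A B hproper hAB hx
      refine ⟨?_, Finset.card_pair k6⟩
      simp only [Finset.insert_subset_iff, Finset.singleton_subset_iff]
      exact ⟨k2, k4⟩)
  have hM := ecrs_M_card G c A B hproper hAB
  have hEE := ecrs_eBetween G A B
  have hpt : 2 * (∑ q ∈ A.powersetCard y ×ˢ B.powersetCard y,
      ((ecrsE G A B).filter (fun p => {p.1} ⊆ q.1 ∧ {p.2} ⊆ q.2)).card) ≤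
      2 * (∑ q ∈ A.powersetCard y ×ˢ B.powersetCard y, colorsBetween G c q.1 q.2) +
      ∑ q ∈ A.powersetCard y ×ˢ B.powersetCard y, ((ecrsM G c A B).filter
        (fun x => {x.1.1, x.2.1} ⊆ q.1 ∧ {x.1.2, x.2.2} ⊆ q.2)).card := by
    rw [Finset.mul_sum, Finset.mul_sum, ← Finset.sum_add_distrib]
    apply Finset.sum_le_sum
    intro q hq
    simp only [Finset.mem_product, Finset.mem_powersetCard] at hq
    exact ecrs_point G c A B q.1 q.2 hq.1.1 hq.2.1
  have hP0 : y = 1 → (∑ q ∈ A.powersetCard y ×ˢ B.powersetCard y, ((ecrsM G c A B).filter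
        (fun x => {x.1.1, x.2.1} ⊆ q.1 ∧ {x.1.2, x.2.2} ⊆ q.2)).card) = 0 := by
    intro hy1
    apply Finset.sum_eq_zero
    intro q hq
    rw [Finset.card_eq_zero, Finset.filter_eq_empty_iff]
    rintro x hx ⟨hs, -⟩
    obtain ⟨k1, k2, k3, k4, k5, k6⟩ := ecrs_M_mem G c A B hproper hAB hx
    have := Finset.card_le_card hs
    rw [Finset.card_pair k5] at this
    simp only [Finset.mem_product, Finset.mem_powersetCard] at hq
    omega
  rw [← Nat.cast_sum]
  rw [hA, hB] at d1 d2 hM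
  generalize (∑ q ∈ A.powersetCard y ×ˢ B.powersetCard y, colorsBetween G c q.1 q.2) = Z at *
  generalize (∑ q ∈ A.powersetCard y ×ˢ B.powersetCard y,
      ((ecrsE G A B).filter (fun p => {p.1} ⊆ q.1 ∧ {p.2} ⊆ q.2)).card) = X at *
  generalize (∑ q ∈ A.powersetCard y ×ˢ B.powersetCard y, ((ecrsM G c A B).filter
        (fun x => {x.1.1, x.2.1} ⊆ q.1 ∧ {x.1.2, x.2.2} ⊆ q.2)).card) = P at *
  generalize (ecrsE G A B).card = e at *
  generalize (ecrsM G c A B).card = m at *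
  generalize eBetween G A B = e' at *
  simp only [Nat.choose_one_right] at d1
  have d1R : (X : ℝ) * (a * b) = e * ((a.choose y * b.choose y) * y ^ 2) := by exact_mod_cast d1
  have d2R : (P : ℝ) * (a.choose 2 * b.choose 2) =
    m * ((a.choose y * b.choose y) * (y.choose 2) ^ 2) := by exact_mod_cast d2
  have hMR : (m : ℝ) ≤ b * (a * (a - 1)) := by
    have : (m : ℝ) ≤ ((b * (a * a - a) : ℕ) : ℝ) := by exact_mod_cast hM
    rw [Nat.cast_mul, Nat.cast_sub (by nlinarith)] at this
    push_cast at this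
    linarith
  have hptR : 2 * (X : ℝ) ≤ 2 * Z + P := by exact_mod_cast hpt
  have hER : (a : ℝ) * b - a * δn ≤ e := hE.trans (by exact_mod_cast hEE)
  have hN : (0 : ℝ) ≤ (a.choose y : ℝ) * b.choose y := by positivity
  generalize (a.choose y : ℝ) * b.choose y = N at *
  have ha : (0 : ℝ) < a := by exact_mod_cast (by omega : 0 < a)
  have hb : (0 : ℝ) < b := by exact_mod_cast (by omega : 0 < b)
  have hX : (1 - ε ^ 2 / 2) * (N * y ^ 2) ≤ X := by
    have h3 : δn ≤ ε ^ 2 / 2 * b := (div_le_iff₀ hb).1 h2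
    have h4 : (1 - ε ^ 2 / 2) * (a * b) ≤ e := by nlinarith
    have h5 := mul_le_mul_of_nonneg_right h4 (by positivity : 0 ≤ N * (y : ℝ) ^ 2)
    rw [← d1R] at h5
    have : (0 : ℝ) < a * b := by positivity
    refine le_of_mul_le_mul_right ?_ this
    linarith
  have hPb : (P : ℝ) ≤ ε ^ 2 * (N * y ^ 2) := by
    by_cases hy1 : y = 1
    · rw [hP0 hy1]; push_cast; positivity
    · have hb1 : (0 : ℝ) < b - 1 := by
        have : (2 : ℝ) ≤ b := by exact_mod_cast (by omega : 2 ≤ b)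
        linarith
      have ha1 : (0 : ℝ) < a - 1 := by
        have : (2 : ℝ) ≤ a := by exact_mod_cast (by omega : 2 ≤ a)
        linarith
      rw [div_le_iff₀ (by positivity)] at h1
      have h1' : ((y : ℝ) - 1) ^ 2 ≤ ε ^ 2 * (b - 1) := by linarith
      have d3 : (P : ℝ) * ((a * (a - 1)) * (b * (b - 1))) = m * (N * (y * (y - 1)) ^ 2) := by
        rw [← ecrs_choose_two, ← ecrs_choose_two, ← ecrs_choose_two]
        linear_combination 4 * d2R
      have d4 : (m : ℝ) * (N * (y * (y - 1)) ^ 2) ≤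
          (b * (a * (a - 1))) * (N * (y * (y - 1)) ^ 2) :=
        mul_le_mul_of_nonneg_right hMR (by positivity)
      have d5 : (b * (a * (a - 1))) * (N * (y : ℝ) ^ 2) * ((y - 1) ^ 2) ≤
          (b * (a * (a - 1))) * (N * (y : ℝ) ^ 2) * (ε ^ 2 * (b - 1)) :=
        mul_le_mul_of_nonneg_left h1' (by positivity)
      have : (0 : ℝ) < (a * (a - 1)) * (b * (b - 1)) := by positivity
      refine le_of_mul_le_mul_right ?_ this
      linarith
  linarith

/-- Fix `ε > 0` and a positive integer `y`.  Let `G` be a properly edge-colored graph with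
disjoint vertex sets `A`, `B` of sizes `a`, `b` where `y ≤ a ≤ b`, such that
`|E(A,B)| ≥ ab - a·δn`, and suppose `(y-1)²/(2(b-1)) ≤ ε²/2` and `δn/b ≤ ε²/2`.  If `S` and
`T` are chosen uniformly at random from the `y`-element subsets of `A` and of `B`
respectively, then the expected number `Z` of distinct colors on the edges between `S` and
`T` satisfies `E(Z) ≥ (1 - ε²) y²`, and the probability that `(S,T)` is
`ε`-nearly-rainbow is at least `1 - ε`. -/
theorem expected_colors_between_random_subsets
    {V : Type*} [Fintype V] (ε : ℝ) (hε : 0 < ε) (y : ℕ) (hy : 0 < y)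
    (G : SimpleGraph V) (c : Sym2 V → ℕ) (A B : Finset V) (a b : ℕ) (δn : ℝ)
    (hproper : IsProperEdgeColoring G c)
    (hAB : Disjoint A B) (hA : A.card = a) (hB : B.card = b)
    (hya : y ≤ a) (hab : a ≤ b) (hδn : 0 ≤ δn)
    (hE : (a : ℝ) * (b : ℝ) - (a : ℝ) * δn ≤ (eBetween G A B : ℝ))
    (h1 : ((y : ℝ) - 1) ^ 2 / (2 * ((b : ℝ) - 1)) ≤ ε ^ 2 / 2)
    (h2 : δn / (b : ℝ) ≤ ε ^ 2 / 2) :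
    (1 - ε ^ 2) * (y : ℝ) ^ 2 ≤
      (∑ q ∈ A.powersetCard y ×ˢ B.powersetCard y, (colorsBetween G c q.1 q.2 : ℝ)) /
        (((A.powersetCard y ×ˢ B.powersetCard y).card : ℝ)) ∧
    1 - ε ≤
      ((((A.powersetCard y ×ˢ B.powersetCard y).filter
          fun q => NearlyRainbow ε G c q.1 q.2).card : ℝ)) /
        (((A.powersetCard y ×ˢ B.powersetCard y).card : ℝ)) := by
  have hexp := ecrs_expect ε y hy G c A B a b δn hproper hAB hA hB hya hab hE h1 h2
  have hcard : (A.powersetCard y ×ˢ B.powersetCard y).card = a.choose y * b.choose y := by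
    rw [Finset.card_product, Finset.card_powersetCard, Finset.card_powersetCard, hA, hB]
  have hNpos : (0 : ℝ) < (a.choose y : ℝ) * b.choose y := by
    have := Nat.choose_pos hya
    have := Nat.choose_pos (hya.trans hab)
    positivity
  rw [hcard, Nat.cast_mul]
  refine ⟨(le_div_iff₀ hNpos).2 hexp, (le_div_iff₀ hNpos).2 ?_⟩
  have hy' : (0 : ℝ) < (y : ℝ) ^ 2 := by positivity
  set D := A.powersetCard y ×ˢ B.powersetCard y with hD
  have hb : ∀ q ∈ D, (colorsBetween G c q.1 q.2 : ℝ) ≤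
      (1 - ε) * y ^ 2 + (if NearlyRainbow ε G c q.1 q.2 then ε * (y : ℝ) ^ 2 else 0) := by
    intro q hq
    simp only [hD, Finset.mem_product, Finset.mem_powersetCard] at hq
    split_ifs with h
    · have h3 := ecrs_colors_le G c q.1 q.2
      rw [hq.1.2, hq.2.2] at h3
      have h4 : (colorsBetween G c q.1 q.2 : ℝ) ≤ y * y := by exact_mod_cast h3
      linarith
    · unfold NearlyRainbow at h
      rw [hq.1.2, hq.2.2] at h
      linarith
  have hs := Finset.sum_le_sum hb
  rw [Finset.sum_add_distrib, ← Finset.sum_filter, Finset.sum_const, Finset.sum_const, hcard,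
    nsmul_eq_mul, nsmul_eq_mul, Nat.cast_mul] at hs
  have hk := hexp.trans hs
  have : (0 : ℝ) < ε * y ^ 2 := by positivity
  refine le_of_mul_le_mul_right ?_ this
  linarith
end
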